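/- Every L^∘-grammar can be converted into an equivalent even-cyclic grammar: for every L^∘-grammar Gr there exists an even-cyclic L^∘-grammar Gr′ with L(Gr) = L(Gr′). -/

import Mathlib

/-- Types of the Lambek calculus with the cyclic shift `L^∘`, built from
primitive types `P` by `\` (`ldiv A B = A \ B`), `/` (`rdiv B A = B / A`),
`·` (`mul`) and the cyclic shift `^∘` (`circ`). -/
inductive Fm (P : Type) : Type
  | prim : P → Fm P
  | ldiv : Fm P → Fm P → Fm P
  | rdiv : Fm P → Fm P → Fm P
  | mul  : Fm P → Fm P → Fm P
  | circ : Fm P → Fm P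
deriving DecidableEq

open Fm

/-- Derivability of sequents in the Lambek calculus with the cyclic shift `L^∘`.
The Boolean flag indicates whether the rule (cut) may be used:
`Dv P true` is `L^∘` (with cut), `Dv P false` is its cut-free part. -/
inductive Dv (P : Type) : Bool → List (Fm P) → Fm P → Prop
  | ax (c : Bool) (A : Fm P) :
      Dv P c [A] A
  | ldivL (c : Bool) (Γ Δ Pi : List (Fm P)) (A B C : Fm P) :
      Dv P c (Γ ++ B :: Δ) C → Dv P c Pi A → Pi ≠ [] →
      Dv P c (Γ ++ Pi ++ ldiv A B :: Δ) C
  | ldivR (c : Bool) (Pi : List (Fm P)) (A B : Fm P) :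
      Dv P c (A :: Pi) B → Pi ≠ [] →
      Dv P c Pi (ldiv A B)
  | rdivL (c : Bool) (Γ Δ Pi : List (Fm P)) (A B C : Fm P) :
      Dv P c (Γ ++ B :: Δ) C → Dv P c Pi A → Pi ≠ [] →
      Dv P c (Γ ++ rdiv B A :: (Pi ++ Δ)) C
  | rdivR (c : Bool) (Pi : List (Fm P)) (A B : Fm P) :
      Dv P c (Pi ++ [A]) B → Pi ≠ [] →
      Dv P c Pi (rdiv B A)
  | mulL (c : Bool) (Γ Δ : List (Fm P)) (A B C : Fm P) :
      Dv P c (Γ ++ A :: B :: Δ) C →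
      Dv P c (Γ ++ mul A B :: Δ) C
  | mulR (c : Bool) (Pi Psi : List (Fm P)) (A B : Fm P) :
      Dv P c Pi A → Dv P c Psi B → Pi ≠ [] → Psi ≠ [] →
      Dv P c (Pi ++ Psi) (mul A B)
  | circR (c : Bool) (Pi : List (Fm P)) (A : Fm P) :
      Dv P c Pi A →
      Dv P c Pi (circ A)
  | circL (c : Bool) (A B : Fm P) :
      Dv P c [B] (circ A) →
      Dv P c [circ B] (circ A)
  | circC (c : Bool) (Pi Psi : List (Fm P)) (A : Fm P) :
      Dv P c (Pi ++ Psi) (circ A) → Pi ≠ [] → Psi ≠ [] →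
      Dv P c (Psi ++ Pi) (circ A)
  | cut (Γ Δ Pi : List (Fm P)) (A B : Fm P) :
      Dv P true Pi A → Dv P true (Γ ++ A :: Δ) B → Pi ≠ [] →
      Dv P true (Γ ++ Pi ++ Δ) B

/-- `cyclicOK true A` says that `A` is even-cyclic (no odd subtype occurrence
of the form `B^∘`); `cyclicOK false A` says that `A` is odd-cyclic (no even
subtype occurrence of the form `B^∘`).  Recall `ldiv A B = A \ B` and
`rdiv B A = B / A`, so the first argument of `ldiv` and the second argument of
`rdiv` are the denominators, where parity flips. -/
def cyclicOK {P : Type} : Bool → Fm P → Prop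
  | _, Fm.prim _ => True
  | b, Fm.ldiv A B => cyclicOK (!b) A ∧ cyclicOK b B
  | b, Fm.rdiv B A => cyclicOK b B ∧ cyclicOK (!b) A
  | b, Fm.mul A B => cyclicOK b A ∧ cyclicOK b B
  | b, Fm.circ A => b = true ∧ cyclicOK b A

/-- The language recognized by a categorial grammar based on a calculus with
derivability relation `K`: the grammar has distinguished type `S` and finite
dictionary `R` (a list of pairs `(a, T)` meaning `a ▷ T`); a nonempty word
`a1…an` is recognized iff there are types `T1,…,Tn` with `ai ▷ Ti` and
`K ⊢ T1,…,Tn → S`. -/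
def GLang {α Ty : Type} (K : List Ty → Ty → Prop) (S : Ty) (R : List (α × Ty)) :
    Set (List α) :=
  { w | w ≠ [] ∧ ∃ Ts : List Ty, List.Forall₂ (fun a T => (a, T) ∈ R) w Ts ∧ K Ts S }

/-- The permutation closure `perm(L)` of a language `L`: all words obtained by
permuting the letters of a word of `L`. -/
def permClosure {α : Type} (L : Set (List α)) : Set (List α) :=
  { w | ∃ v ∈ L, w.Perm v }

namespace LC

variable {P Q : Type}

theorem Dv.ne {c : Bool} {Γ : List (Fm P)} {C : Fm P} (h : Dv P c Γ C) : Γ ≠ [] := by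
  induction h <;> simp_all

/-! ### Semantic cut elimination -/

def sem : Fm P → Set (List (Fm P))
  | prim p => {X | Dv P false X (prim p)}
  | ldiv A B => {X | X ≠ [] ∧ ∀ Y ∈ sem A, Y ++ X ∈ sem B}
  | rdiv B A => {X | X ≠ [] ∧ ∀ Y ∈ sem A, X ++ Y ∈ sem B}
  | mul A B => {X | X ≠ [] ∧ ∀ Γ Δ C,
      (∀ Y ∈ sem A, ∀ Z ∈ sem B, Dv P false (Γ ++ (Y ++ (Z ++ Δ))) C) → Dv P false (Γ ++ (X ++ Δ)) C}
  | circ A => {X | X ≠ [] ∧ ∀ C, (∀ Y ∈ sem A, Dv P false Y (circ C)) → Dv P false X (circ C)}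

theorem sem_ne : ∀ (A : Fm P) (X : List (Fm P)), X ∈ sem A → X ≠ []
  | prim _, _, h => Dv.ne h
  | ldiv _ _, _, h => h.1
  | rdiv _ _, _, h => h.1
  | mul _ _, _, h => h.1
  | circ _, _, h => h.1

theorem sem_closed : ∀ (A : Fm P) (X : List (Fm P)), X ≠ [] →
    (∀ Γ Δ C, (∀ Y ∈ sem A, Dv P false (Γ ++ (Y ++ Δ)) C) → Dv P false (Γ ++ (X ++ Δ)) C) →
    X ∈ sem A
  | prim p, X, _, h => by
      have := h [] [] (prim p) (fun Y hY => by
        have hY' : Dv P false Y (prim p) := hY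
        simpa using hY')
      have h' : Dv P false X (prim p) := by simpa using this
      exact h'
  | ldiv A B, X, hX, h => by
      refine ⟨hX, fun Y hY => sem_closed B _ (by simp [hX]) ?_⟩
      intro Γ Δ C hC
      have := h (Γ ++ Y) Δ C (fun Z hZ => by simpa using hC _ (hZ.2 Y hY))
      simpa using this
  | rdiv B A, X, hX, h => by
      refine ⟨hX, fun Y hY => sem_closed B _ (by simp [hX]) ?_⟩
      intro Γ Δ C hC
      have := h Γ (Y ++ Δ) C (fun Z hZ => by simpa using hC _ (hZ.2 Y hY))
      simpa using this
  | mul A B, X, hX, h => ⟨hX, fun Γ Δ C hC => h Γ Δ C (fun Y hY => hY.2 Γ Δ C hC)⟩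
  | circ A, X, hX, h => ⟨hX, fun C hC => by
      have := h [] [] (circ C) (fun Y hY => by simpa using hY.2 C hC)
      simpa using this⟩

def semL : List (Fm P) → Set (List (Fm P))
  | [] => {[]}
  | A :: Γ => {X | ∃ Y ∈ sem A, ∃ Z ∈ semL Γ, X = Y ++ Z}

theorem semL_append (Γ Δ : List (Fm P)) (X : List (Fm P)) :
    X ∈ semL (Γ ++ Δ) ↔ ∃ Y ∈ semL Γ, ∃ Z ∈ semL Δ, X = Y ++ Z := by
  induction Γ generalizing X with
  | nil => simp [semL]
  | cons A Γ ih =>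
    constructor
    · rintro ⟨Y, hY, Z, hZ, rfl⟩
      obtain ⟨Y', hY', Z', hZ', rfl⟩ := (ih _).1 hZ
      exact ⟨Y ++ Y', ⟨Y, hY, Y', hY', rfl⟩, Z', hZ', by simp⟩
    · rintro ⟨_, ⟨Y, hY, Y', hY', rfl⟩, Z', hZ', rfl⟩
      exact ⟨Y, hY, Y' ++ Z', (ih _).2 ⟨Y', hY', Z', hZ', rfl⟩, by simp⟩

theorem semL_ne {Γ : List (Fm P)} (hΓ : Γ ≠ []) {X : List (Fm P)} (h : X ∈ semL Γ) : X ≠ [] := by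
  cases Γ with
  | nil => exact absurd rfl hΓ
  | cons A Γ =>
    obtain ⟨Y, hY, Z, hZ, rfl⟩ := h
    have := sem_ne _ _ hY
    simp [this]

theorem sound {c : Bool} {Γ : List (Fm P)} {C : Fm P} (h : Dv P c Γ C) :
    ∀ X ∈ semL Γ, X ∈ sem C := by
  induction h with
  | ax c A =>
    rintro X ⟨Y, hY, Z, rfl, rfl⟩
    simpa using hY
  | ldivL c Γ Δ Pi A B C _ _ hPi ih1 ih2 =>
    intro X hX
    obtain ⟨Y, hY, Z, ⟨f, hf, d, hd, rfl⟩, rfl⟩ := (semL_append _ _ _).1 hX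
    obtain ⟨g, hg, p, hp, rfl⟩ := (semL_append _ _ _).1 hY
    have := ih1 (g ++ ((p ++ f) ++ d))
      ((semL_append _ _ _).2 ⟨g, hg, _, ⟨_, hf.2 p (ih2 p hp), d, hd, rfl⟩, rfl⟩)
    simpa using this
  | rdivL c Γ Δ Pi A B C _ _ hPi ih1 ih2 =>
    intro X hX
    obtain ⟨g, hg, Z, ⟨f, hf, Z', hZ', rfl⟩, rfl⟩ := (semL_append _ _ _).1 hX
    obtain ⟨p, hp, d, hd, rfl⟩ := (semL_append _ _ _).1 hZ'
    have := ih1 (g ++ ((f ++ p) ++ d))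
      ((semL_append _ _ _).2 ⟨g, hg, _, ⟨_, hf.2 p (ih2 p hp), d, hd, rfl⟩, rfl⟩)
    simpa using this
  | ldivR c Pi A B _ hPi ih =>
    intro X hX
    exact ⟨semL_ne hPi hX, fun Y hY => ih _ ⟨Y, hY, X, hX, rfl⟩⟩
  | rdivR c Pi A B _ hPi ih =>
    intro X hX
    exact ⟨semL_ne hPi hX, fun Y hY =>
      ih _ ((semL_append _ _ _).2 ⟨X, hX, Y, ⟨Y, hY, [], rfl, by simp⟩, rfl⟩)⟩
  | mulL c Γ Δ A B C _ ih =>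
    intro X hX
    obtain ⟨g, hg, Z, ⟨m, hm, d, hd, rfl⟩, rfl⟩ := (semL_append _ _ _).1 hX
    refine sem_closed _ _ (by simp [hm.1]) ?_
    intro Γ' Δ' C' hC'
    have := hm.2 (Γ' ++ g) (d ++ Δ') C' (fun Y hY Z hZ => by
      have := hC' _ (ih (g ++ (Y ++ (Z ++ d)))
        ((semL_append _ _ _).2 ⟨g, hg, _, ⟨Y, hY, _, ⟨Z, hZ, d, hd, rfl⟩, rfl⟩, rfl⟩))
      simpa using this)
    simpa using this
  | mulR c Pi Psi A B _ _ h1 h2 ih1 ih2 =>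
    intro X hX
    obtain ⟨Y, hY, Z, hZ, rfl⟩ := (semL_append _ _ _).1 hX
    refine ⟨by simp [semL_ne h1 hY], fun Γ Δ C hC => ?_⟩
    have := hC Y (ih1 _ hY) Z (ih2 _ hZ)
    simpa using this
  | circR c Pi A h ih =>
    intro X hX
    exact ⟨sem_ne _ _ (ih X hX), fun C hC => hC X (ih X hX)⟩
  | circL c A B h ih =>
    rintro X ⟨Y, hY, Z, rfl, rfl⟩
    simp only [List.append_nil]
    exact ⟨hY.1, fun C hC => hY.2 C (fun W hW =>
      (ih W ⟨W, hW, [], rfl, by simp⟩).2 C hC)⟩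
  | circC c Pi Psi A _ h1 h2 ih =>
    intro X hX
    obtain ⟨Y, hY, Z, hZ, rfl⟩ := (semL_append _ _ _).1 hX
    refine ⟨by simp [semL_ne h2 hY], fun C hC => ?_⟩
    exact Dv.circC _ _ _ _ ((ih (Z ++ Y) ((semL_append _ _ _).2 ⟨Z, hZ, Y, hY, rfl⟩)).2 C hC)
      (semL_ne h1 hZ) (semL_ne h2 hY)
  | cut Γ Δ Pi A B _ _ hPi ih1 ih2 =>
    intro X hX
    obtain ⟨Y, hY, d, hd, rfl⟩ := (semL_append _ _ _).1 hX
    obtain ⟨g, hg, p, hp, rfl⟩ := (semL_append _ _ _).1 hY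
    have := ih2 (g ++ (p ++ d))
      ((semL_append _ _ _).2 ⟨g, hg, _, ⟨p, ih1 p hp, d, hd, rfl⟩, rfl⟩)
    simpa using this

theorem sem_main : ∀ A : Fm P, [A] ∈ sem A ∧ ∀ X ∈ sem A, Dv P false X A
  | prim p => ⟨Dv.ax _ _, fun X hX => hX⟩
  | ldiv A B => by
      obtain ⟨a1, a2⟩ := sem_main A
      obtain ⟨b1, b2⟩ := sem_main B
      refine ⟨⟨by simp, fun Y hY => sem_closed _ _ (by simp) ?_⟩, fun X hX => ?_⟩
      · intro Γ Δ C hC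
        have := Dv.ldivL false Γ Δ Y A B C (by simpa using hC _ b1) (a2 Y hY) (sem_ne _ _ hY)
        simpa using this
      · exact Dv.ldivR _ _ _ _ (b2 _ (hX.2 _ a1)) hX.1
  | rdiv B A => by
      obtain ⟨a1, a2⟩ := sem_main A
      obtain ⟨b1, b2⟩ := sem_main B
      refine ⟨⟨by simp, fun Y hY => sem_closed _ _ (by simp) ?_⟩, fun X hX => ?_⟩
      · intro Γ Δ C hC
        have := Dv.rdivL false Γ Δ Y A B C (by simpa using hC _ b1) (a2 Y hY) (sem_ne _ _ hY)
        simpa using this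
      · exact Dv.rdivR _ _ _ _ (b2 _ (hX.2 _ a1)) hX.1
  | mul A B => by
      obtain ⟨a1, a2⟩ := sem_main A
      obtain ⟨b1, b2⟩ := sem_main B
      refine ⟨⟨by simp, fun Γ Δ C hC => ?_⟩, fun X hX => ?_⟩
      · exact Dv.mulL _ _ _ _ _ _ (by simpa using hC _ a1 _ b1)
      · have := hX.2 [] [] (mul A B) (fun Y hY Z hZ => by
          simpa using Dv.mulR false Y Z A B (a2 _ hY) (b2 _ hZ) (sem_ne _ _ hY) (sem_ne _ _ hZ))
        simpa using this
  | circ A => by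
      obtain ⟨a1, a2⟩ := sem_main A
      refine ⟨⟨by simp, fun C hC => Dv.circL _ _ _ (hC _ a1)⟩, fun X hX => ?_⟩
      exact hX.2 A (fun Y hY => Dv.circR _ _ _ (a2 _ hY))

theorem mem_semL_self (Γ : List (Fm P)) : Γ ∈ semL Γ := by
  induction Γ with
  | nil => rfl
  | cons A Γ ih => exact ⟨[A], (sem_main A).1, Γ, ih, rfl⟩

theorem cut_elim {c : Bool} {Γ : List (Fm P)} {C : Fm P} (h : Dv P c Γ C) : Dv P false Γ C :=
  (sem_main C).2 _ (sound h _ (mem_semL_self Γ))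

theorem addcut {c : Bool} {Γ : List (Fm P)} {C : Fm P} (h : Dv P c Γ C) : Dv P true Γ C := by
  induction h with
  | ax => exact Dv.ax _ _
  | ldivL c Γ Δ Pi A B C _ _ h i1 i2 => exact Dv.ldivL _ _ _ _ _ _ _ i1 i2 h
  | ldivR c Pi A B _ h i => exact Dv.ldivR _ _ _ _ i h
  | rdivL c Γ Δ Pi A B C _ _ h i1 i2 => exact Dv.rdivL _ _ _ _ _ _ _ i1 i2 h
  | rdivR c Pi A B _ h i => exact Dv.rdivR _ _ _ _ i h
  | mulL c Γ Δ A B C _ i => exact Dv.mulL _ _ _ _ _ _ i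
  | mulR c Pi Psi A B _ _ h1 h2 i1 i2 => exact Dv.mulR _ _ _ _ _ i1 i2 h1 h2
  | circR c Pi A _ i => exact Dv.circR _ _ _ i
  | circL c A B _ i => exact Dv.circL _ _ _ i
  | circC c Pi Psi A _ h1 h2 i => exact Dv.circC _ _ _ _ i h1 h2
  | cut Γ Δ Pi A B _ _ h i1 i2 => exact Dv.cut _ _ _ _ _ i1 i2 h

/-! ### Substitution -/

def sub (s : P → Fm Q) : Fm P → Fm Q
  | prim p => s p
  | ldiv A B => ldiv (sub s A) (sub s B)
  | rdiv B A => rdiv (sub s B) (sub s A)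
  | mul A B => mul (sub s A) (sub s B)
  | circ A => circ (sub s A)

theorem Dv.sub (s : P → Fm Q) {c : Bool} {Γ : List (Fm P)} {C : Fm P} (h : Dv P c Γ C) :
    Dv Q c (Γ.map (sub s)) (sub s C) := by
  induction h with
  | ax => exact Dv.ax _ _
  | ldivL c Γ Δ Pi A B C _ _ h i1 i2 =>
    simp only [List.map_append, List.map_cons, LC.sub] at *
    exact Dv.ldivL _ _ _ _ _ _ _ i1 i2 (by simpa using h)
  | ldivR c Pi A B _ h i => exact Dv.ldivR _ _ _ _ i (by simpa using h)
  | rdivL c Γ Δ Pi A B C _ _ h i1 i2 =>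
    simp only [List.map_append, List.map_cons, LC.sub] at *
    exact Dv.rdivL _ _ _ _ _ _ _ i1 i2 (by simpa using h)
  | rdivR c Pi A B _ h i => exact Dv.rdivR _ _ _ _ (by simpa using i) (by simpa using h)
  | mulL c Γ Δ A B C _ i =>
    simp only [List.map_append, List.map_cons, LC.sub] at *
    exact Dv.mulL _ _ _ _ _ _ i
  | mulR c Pi Psi A B _ _ h1 h2 i1 i2 =>
    simp only [List.map_append, LC.sub] at *
    exact Dv.mulR _ _ _ _ _ i1 i2 (by simpa using h1) (by simpa using h2)
  | circR c Pi A _ i => exact Dv.circR _ _ _ i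
  | circL c A B _ i => exact Dv.circL _ _ _ i
  | circC c Pi Psi A _ h1 h2 i =>
    simp only [List.map_append, LC.sub] at *
    exact Dv.circC _ _ _ _ i (by simpa using h1) (by simpa using h2)
  | cut Γ Δ Pi A B _ _ h i1 i2 =>
    simp only [List.map_append, List.map_cons] at *
    exact Dv.cut _ _ _ _ _ i1 i2 (by simpa using h)

/-! ### Step 1: primitive distinguished type -/

def up (A : Fm ℕ) : Fm ℕ := sub (fun n => prim (n + 1)) A

theorem down_up (A : Fm ℕ) : sub (fun n => prim (n - 1)) (up A) = A := by
  unfold up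
  induction A <;> simp_all [sub]

def sfree : Fm ℕ → Prop
  | prim n => n ≠ 0
  | ldiv A B => sfree A ∧ sfree B
  | rdiv B A => sfree B ∧ sfree A
  | mul A B => sfree A ∧ sfree B
  | circ A => sfree A

theorem sfree_up (A : Fm ℕ) : sfree (up A) := by
  unfold up
  induction A <;> simp_all [sub, sfree]

def cnt : Fm ℕ → ℤ
  | prim n => if n = 0 then 1 else 0
  | ldiv A B => cnt B - cnt A
  | rdiv B A => cnt B - cnt A
  | mul A B => cnt A + cnt B
  | circ A => cnt A

theorem cnt_sfree (A : Fm ℕ) (h : sfree A) : cnt A = 0 := by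
  induction A <;> simp_all [cnt, sfree]

theorem cnt_Dv {c : Bool} {Γ : List (Fm ℕ)} {C : Fm ℕ} (h : Dv ℕ c Γ C) :
    (Γ.map cnt).sum = cnt C := by
  induction h <;> simp [cnt] at * <;> linarith

def special (S F : Fm ℕ) : Prop :=
  F = prim 0 ∨ F = rdiv (prim 0) S ∨ ∃ T, sfree T ∧ F = mul (rdiv (prim 0) S) T

theorem cnt_special {S F : Fm ℕ} (hS : sfree S) (h : special S F) : cnt F = 1 := by
  rcases h with rfl | rfl | ⟨T, hT, rfl⟩
  · simp [cnt]
  · simp [cnt, cnt_sfree S hS]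
  · simp [cnt, cnt_sfree S hS, cnt_sfree T hT]

theorem all_sfree {S : Fm ℕ} (hS : sfree S) (Γ : List (Fm ℕ))
    (hΓ : ∀ F ∈ Γ, sfree F ∨ special S F) :
    0 ≤ (Γ.map cnt).sum ∧ ((Γ.map cnt).sum = 0 → ∀ F ∈ Γ, sfree F) := by
  induction Γ with
  | nil => simp
  | cons A Γ ih =>
    obtain ⟨i1, i2⟩ := ih (fun F hF => hΓ F (by simp [hF]))
    rcases hΓ A (by simp) with h | h
    · have := cnt_sfree A h
      simp only [List.map_cons, List.sum_cons, this, zero_add]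
      exact ⟨i1, fun h0 => by simpa [h] using i2 h0⟩
    · have := cnt_special hS h
      simp only [List.map_cons, List.sum_cons, this]
      exact ⟨by linarith, fun h0 => by exfalso; linarith⟩

theorem not_sfree_special {S F : Fm ℕ} (h : special S F) : ¬ sfree F := by
  rcases h with rfl | rfl | ⟨T, hT, rfl⟩ <;> simp [sfree]

theorem arg_sfree {S : Fm ℕ} (hS : sfree S) {c : Bool} {Pi : List (Fm ℕ)} {A : Fm ℕ}
    (hA : sfree A) (h : Dv ℕ c Pi A) (hPi : ∀ F ∈ Pi, sfree F ∨ special S F) :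
    ∀ F ∈ Pi, sfree F :=
  (all_sfree hS Pi hPi).2 (by rw [cnt_Dv h, cnt_sfree A hA])

/-- shape of antecedents deriving the fresh primitive type -/
def Shape (S : Fm ℕ) (Γ : List (Fm ℕ)) : Prop :=
  Γ = [prim 0] ∨
  (∃ Δ, Γ = rdiv (prim 0) S :: Δ ∧ (∀ F ∈ Δ, sfree F) ∧ Dv ℕ false Δ S) ∨
  (∃ T Δ, sfree T ∧ Γ = mul (rdiv (prim 0) S) T :: Δ ∧ (∀ F ∈ Δ, sfree F) ∧
    Dv ℕ false (T :: Δ) S)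

/-- Replace an s-free stretch in a `Shape`. -/
theorem Shape.repl {S : Fm ℕ} {Γ Δ X Y : List (Fm ℕ)} (hX0 : X ≠ []) (hX : ∀ F ∈ X, sfree F)
    (hY : ∀ F ∈ Y, sfree F)
    (hr : ∀ Γ C, Dv ℕ false (Γ ++ X ++ Δ) C → Dv ℕ false (Γ ++ Y ++ Δ) C)
    (h : Shape S (Γ ++ X ++ Δ)) : Shape S (Γ ++ Y ++ Δ) := by
  cases Γ with
  | nil =>
    exfalso
    cases X with
    | nil => exact hX0 rfl
    | cons x X =>
      have hx := hX x (by simp)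
      rcases h with h | ⟨Δ', h, _⟩ | ⟨T, Δ', _, h, _⟩
      all_goals
        simp at h
        rw [h.1] at hx
        simp [sfree] at hx
  | cons g Γ =>
    rcases h with h | ⟨Δ', h, h2, h3⟩ | ⟨T, Δ', hT, h, h2, h3⟩
    · simp at h
      exact absurd h.2.2.1 hX0
    · simp at h
      obtain ⟨rfl, rfl⟩ := h
      refine Or.inr (Or.inl ⟨Γ ++ Y ++ Δ, by simp, ?_, hr _ _ (by simpa using h3)⟩)
      intro F hF
      simp at hF h2
      grind
    · simp at h
      obtain ⟨rfl, rfl⟩ := h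
      refine Or.inr (Or.inr ⟨T, Γ ++ Y ++ Δ, hT, by simp, ?_, ?_⟩)
      · intro F hF
        simp at hF h2
        grind
      · have := hr (T :: Γ) S (by simpa using h3)
        simpa using this

theorem shape_of {S : Fm ℕ} (hS : sfree S) {c : Bool} {Γ : List (Fm ℕ)} {C : Fm ℕ}
    (h : Dv ℕ c Γ C) (hc : c = false) (hC : C = prim 0)
    (hΓ : ∀ F ∈ Γ, sfree F ∨ special S F) : Shape S Γ := by
  induction h with
  | ax c A => subst hC; exact Or.inl rfl
  | ldivL c Γ Δ Pi A B C h1 h2 hPi i1 i2 =>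
    subst hc
    have hf : sfree (ldiv A B) := by
      rcases hΓ (ldiv A B) (by simp) with h | h
      · exact h
      · simp [special] at h
    have hPs := arg_sfree hS hf.1 h2 (fun F hF => hΓ F (by simp [hF]))
    have := i1 rfl hC (by
      intro F hF
      simp at hF
      rcases hF with hF | rfl | hF
      · exact hΓ F (by simp [hF])
      · exact Or.inl hf.2
      · exact hΓ F (by simp [hF]))
    have := Shape.repl (Γ := Γ) (Δ := Δ) (X := [B]) (Y := Pi ++ [ldiv A B]) (by simp)
      (by simpa using hf.2)
      (by intro F hF; simp at hF; rcases hF with hF | rfl; exacts [hPs F hF, hf])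
      (by
        intro Γ C hh
        have := Dv.ldivL false Γ Δ Pi A B C (by simpa using hh) h2 hPi
        simpa using this) (by simpa using this)
    simpa using this
  | ldivR c Pi A B _ h i => cases hC
  | rdivL c Γ Δ Pi A B C h1 h2 hPi i1 i2 =>
    subst hc
    rcases hΓ (rdiv B A) (by simp) with hf | hf
    · have hPs := arg_sfree hS hf.2 h2 (fun F hF => hΓ F (by simp [hF]))
      have := i1 rfl hC (by
        intro F hF
        simp at hF
        rcases hF with hF | rfl | hF
        · exact hΓ F (by simp [hF])
        · exact Or.inl hf.1
        · exact hΓ F (by simp [hF]))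
      have := Shape.repl (Γ := Γ) (Δ := Δ) (X := [B]) (Y := rdiv B A :: Pi) (by simp)
        (by simpa using hf.1)
        (by intro F hF; simp at hF; rcases hF with rfl | hF; exacts [hf, hPs F hF])
        (by
          intro Γ C hh
          have := Dv.rdivL false Γ Δ Pi A B C (by simpa using hh) h2 hPi
          simpa using this) (by simpa using this)
      simpa using this
    · simp [special] at hf
      obtain ⟨rfl, rfl⟩ := hf
      have hPs := arg_sfree hS hS h2 (fun F hF => hΓ F (by simp [hF]))
      have := i1 rfl hC (by
        intro F hF
        simp at hF
        rcases hF with hF | rfl | hF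
        · exact hΓ F (by simp [hF])
        · exact Or.inr (Or.inl rfl)
        · exact hΓ F (by simp [hF]))
      cases Γ with
      | nil =>
        rcases this with h | ⟨Δ', h, _⟩ | ⟨T, Δ', _, h, _⟩
        · simp at h
          subst h
          exact Or.inr (Or.inl ⟨Pi, by simp, hPs, h2⟩)
        · simp at h
        · simp at h
      | cons g Γ =>
        exfalso
        rcases this with h | ⟨Δ', h, h', _⟩ | ⟨T, Δ', _, h, h', _⟩
        · simp at h
        · simp at h
          have := h' (prim 0) (by simp [← h.2])
          simp [sfree] at this
        · simp at h
          have := h' (prim 0) (by simp [← h.2])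
          simp [sfree] at this
  | rdivR c Pi A B _ h i => cases hC
  | mulL c Γ Δ A B C h1 i =>
    subst hc
    rcases hΓ (mul A B) (by simp) with hf | hf
    · have := i rfl hC (by
        intro F hF
        simp at hF
        rcases hF with hF | rfl | rfl | hF
        · exact hΓ F (by simp [hF])
        · exact Or.inl hf.1
        · exact Or.inl hf.2
        · exact hΓ F (by simp [hF]))
      have := Shape.repl (Γ := Γ) (Δ := Δ) (X := [A, B]) (Y := [mul A B]) (by simp)
        (by simpa [sfree] using hf)
        (by simpa using hf)
        (by
          intro Γ C hh
          have := Dv.mulL false Γ Δ A B C (by simpa using hh)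
          simpa using this) (by simpa using this)
      simpa using this
    · simp [special] at hf
      obtain ⟨hB, rfl⟩ := hf
      have := i rfl hC (by
        intro F hF
        simp at hF
        rcases hF with hF | rfl | rfl | hF
        · exact hΓ F (by simp [hF])
        · exact Or.inr (Or.inr (Or.inl rfl))
        · exact Or.inl hB
        · exact hΓ F (by simp [hF]))
      cases Γ with
      | nil =>
        rcases this with h | ⟨Δ', h, h2, h3⟩ | ⟨T, Δ', _, h, _⟩
        · simp at h
        · simp at h
          subst h
          exact Or.inr (Or.inr ⟨B, Δ, hB, by simp, fun F hF => h2 F (by simp [hF]), h3⟩)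
        · simp at h
      | cons g Γ =>
        exfalso
        rcases this with h | ⟨Δ', h, h', _⟩ | ⟨T, Δ', _, h, h', _⟩
        · simp at h
        · simp at h
          have := h' (rdiv (prim 0) S) (by simp [← h.2])
          simp [sfree] at this
        · simp at h
          have := h' (rdiv (prim 0) S) (by simp [← h.2])
          simp [sfree] at this
  | mulR c Pi Psi A B _ _ h1 h2 i1 i2 => cases hC
  | circR c Pi A _ i => cases hC
  | circL c A B _ i => cases hC
  | circC c Pi Psi A _ h1 h2 i => cases hC
  | cut Γ Δ Pi A B _ _ h i1 i2 => cases hc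

theorem step1 (α : Type) (S : Fm ℕ) (rel : List (α × Fm ℕ)) :
    ∃ (n : ℕ) (rel' : List (α × Fm ℕ)),
      GLang (Dv ℕ true) S rel = GLang (Dv ℕ true) (prim n) rel' := by
  refine ⟨0, rel.map (fun p => (p.1, up p.2)) ++
    rel.map (fun p => (p.1, mul (rdiv (prim 0) (up S)) (up p.2))), ?_⟩
  ext w
  constructor
  · rintro ⟨hw, Ts, hTs, hD⟩
    refine ⟨hw, ?_⟩
    have hD' : Dv ℕ true (Ts.map up) (up S) := Dv.sub _ hD
    cases hTs with
    | nil => exact absurd rfl hw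
    | @cons a T w Ts h1 h2 =>
      refine ⟨mul (rdiv (prim 0) (up S)) (up T) :: Ts.map up, List.Forall₂.cons ?_ ?_, ?_⟩
      · simp only [List.mem_append, List.mem_map]
        exact Or.inr ⟨(a, T), h1, rfl⟩
      · rw [List.forall₂_map_right_iff]
        refine h2.imp ?_
        intro a T h
        simp only [List.mem_append, List.mem_map]
        exact Or.inl ⟨(a, T), h, rfl⟩
      · have := Dv.rdivL true [] [] (up T :: Ts.map up) (up S) (prim 0) (prim 0) (Dv.ax _ _)
          (by simpa using hD') (by simp)
        exact Dv.mulL true [] _ _ _ _ (by simpa using this)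
  · rintro ⟨hw, Ts, hTs, hD⟩
    refine ⟨hw, ?_⟩
    have hall : ∀ F ∈ Ts, sfree F ∨ ∃ T, F = mul (rdiv (prim 0) (up S)) (up T) := by
      clear hD hw
      induction hTs with
      | nil => simp
      | cons h _ ih =>
        intro F hF
        simp at hF
        rcases hF with rfl | hF
        · simp at h
          rcases h with ⟨T, _, rfl⟩ | ⟨T, _, rfl⟩
          · exact Or.inl (sfree_up _)
          · exact Or.inr ⟨_, rfl⟩
        · exact ih F hF
    have hsh := shape_of (S := up S) (sfree_up S) (cut_elim hD) rfl rfl (by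
      intro F hF
      rcases hall F hF with h | ⟨T, rfl⟩
      · exact Or.inl h
      · exact Or.inr (Or.inr (Or.inr ⟨_, sfree_up T, rfl⟩)))
    rcases hsh with rfl | ⟨Δ, rfl, _⟩ | ⟨T, Δ, hT, rfl, hΔ, h3⟩
    · have := hall (prim 0) (by simp)
      simp [sfree] at this
    · have := hall (rdiv (prim 0) (up S)) (by simp)
      simp [sfree] at this
    · have h4 := Dv.sub (fun n => (prim (n - 1) : Fm ℕ)) (addcut h3)
      rw [down_up] at h4
      refine ⟨_, ?_, h4⟩
      cases hTs with
      | @cons a _ w _ h1 h2 =>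
        refine List.Forall₂.cons ?_ ?_
        · simp only [List.mem_append, List.mem_map, Prod.mk.injEq] at h1
          rcases h1 with ⟨p, hp, _, h⟩ | ⟨p, hp, rfl, h⟩
          · have := sfree_up p.2
            rw [h] at this
            simp [sfree] at this
          · simp only [mul.injEq, true_and] at h
            rw [← h, down_up]
            exact hp
        · rw [List.forall₂_map_right_iff]
          clear h1 h3 h4 hall hw hD
          induction h2 with
          | nil => exact List.Forall₂.nil
          | @cons a F w Δ h1 h2 ih =>
            refine List.Forall₂.cons ?_ (ih (fun F hF => hΔ F (by simp [hF])))
            have hF := hΔ F (by simp)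
            simp only [List.mem_append, List.mem_map, Prod.mk.injEq] at h1
            rcases h1 with ⟨p, hp, rfl, rfl⟩ | ⟨p, hp, rfl, rfl⟩
            · rw [down_up]
              exact hp
            · simp [sfree] at hF

/-! ### Step 2: variants -/

def csub : Fm ℕ → List (Fm ℕ)
  | prim _ => []
  | ldiv A B => csub A ++ csub B
  | rdiv B A => csub B ++ csub A
  | mul A B => csub A ++ csub B
  | circ A => A :: csub A

def q (L : List (Fm ℕ)) (B : Fm ℕ) : Fm ℕ := prim (2 * L.idxOf B + 1)

/-- `Var L b F F'`: `F'` is a variant of `F`, where `b = true` means succedent polarity. -/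
def Var (L : List (Fm ℕ)) : Bool → Fm ℕ → Fm ℕ → Prop
  | _, prim n, F' => F' = prim (2 * n)
  | b, ldiv A B, F' => ∃ A' B', Var L (!b) A A' ∧ Var L b B B' ∧ F' = ldiv A' B'
  | b, rdiv B A, F' => ∃ A' B', Var L (!b) A A' ∧ Var L b B B' ∧ F' = rdiv B' A'
  | b, mul A B, F' => ∃ A' B', Var L b A A' ∧ Var L b B B' ∧ F' = mul A' B'
  | false, circ B, F' => F' = q L B
  | true, circ A, F' => (∃ A', Var L true A A' ∧ F' = circ A') ∨
      ∃ B ∈ L, Dv ℕ true [B] (circ A) ∧ F' = circ (q L B)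

theorem Var_finite (L : List (Fm ℕ)) : ∀ (F : Fm ℕ) (b : Bool), {F' | Var L b F F'}.Finite := by
  intro F
  induction F with
  | prim n => intro b; simp [Var]
  | ldiv A B iA iB =>
    intro b
    refine (((iA (!b)).prod (iB b)).image (fun p => ldiv p.1 p.2)).subset ?_
    rintro _ ⟨A', B', h1, h2, rfl⟩
    exact ⟨(A', B'), ⟨h1, h2⟩, rfl⟩
  | rdiv B A iB iA =>
    intro b
    refine (((iA (!b)).prod (iB b)).image (fun p => rdiv p.2 p.1)).subset ?_
    rintro _ ⟨A', B', h1, h2, rfl⟩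
    exact ⟨(A', B'), ⟨h1, h2⟩, rfl⟩
  | mul A B iA iB =>
    intro b
    refine (((iA b).prod (iB b)).image (fun p => mul p.1 p.2)).subset ?_
    rintro _ ⟨A', B', h1, h2, rfl⟩
    exact ⟨(A', B'), ⟨h1, h2⟩, rfl⟩
  | circ A iA =>
    intro b
    cases b with
    | false => simp [Var]
    | true =>
      refine (((iA true).image circ).union
        ((List.finite_toSet L).image (fun B => circ (q L B)))).subset ?_
      rintro _ (⟨A', h, rfl⟩ | ⟨B, hB, _, rfl⟩)
      · exact Or.inl ⟨A', h, rfl⟩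
      · exact Or.inr ⟨B, hB, rfl⟩

theorem Var_cyclic (L : List (Fm ℕ)) :
    ∀ (F : Fm ℕ) (b : Bool) (F' : Fm ℕ), Var L b F F' → cyclicOK b F' := by
  intro F
  induction F with
  | prim n => rintro b _ rfl; simp [cyclicOK]
  | ldiv A B iA iB =>
    rintro b _ ⟨A', B', h1, h2, rfl⟩
    exact ⟨iA _ _ h1, iB _ _ h2⟩
  | rdiv B A iB iA =>
    rintro b _ ⟨A', B', h1, h2, rfl⟩
    exact ⟨iB _ _ h2, iA _ _ h1⟩
  | mul A B iA iB =>
    rintro b _ ⟨A', B', h1, h2, rfl⟩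
    exact ⟨iA _ _ h1, iB _ _ h2⟩
  | circ A iA =>
    intro b F' h
    cases b with
    | false => cases h; simp [q, cyclicOK]
    | true =>
      rcases h with ⟨A', h, rfl⟩ | ⟨B, hB, _, rfl⟩
      · exact ⟨rfl, iA _ _ h⟩
      · simp [q, cyclicOK]

def back (L : List (Fm ℕ)) (n : ℕ) : Fm ℕ :=
  if n % 2 = 0 then prim (n / 2) else circ (L.getD (n / 2) (prim 0))

theorem back_q (L : List (Fm ℕ)) (B : Fm ℕ) (h : B ∈ L) : sub (back L) (q L B) = circ B := by
  have h1 : (2 * L.idxOf B + 1) % 2 = 1 := by omega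
  have h2 : (2 * L.idxOf B + 1) / 2 = L.idxOf B := by omega
  have h3 : L.idxOf B < L.length := List.idxOf_lt_length_of_mem h
  simp [q, sub, back, h1, h2, h3]

theorem mono_ldiv {A A' B B' : Fm ℕ} (h1 : Dv ℕ true [A'] A) (h2 : Dv ℕ true [B] B') :
    Dv ℕ true [ldiv A B] (ldiv A' B') :=
  Dv.ldivR _ _ _ _ (Dv.ldivL true [] [] [A'] A B B' h2 h1 (by simp)) (by simp)

theorem mono_rdiv {A A' B B' : Fm ℕ} (h1 : Dv ℕ true [A'] A) (h2 : Dv ℕ true [B] B') :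
    Dv ℕ true [rdiv B A] (rdiv B' A') :=
  Dv.rdivR _ _ _ _ (Dv.rdivL true [] [] [A'] A B B' h2 h1 (by simp)) (by simp)

theorem mono_mul {A A' B B' : Fm ℕ} (h1 : Dv ℕ true [A] A') (h2 : Dv ℕ true [B] B') :
    Dv ℕ true [mul A B] (mul A' B') :=
  Dv.mulL true [] [] _ _ _ (Dv.mulR true [A] [B] _ _ h1 h2 (by simp) (by simp))

theorem Var_back (L : List (Fm ℕ)) : ∀ (F : Fm ℕ), csub F ⊆ L →
    (∀ F', Var L false F F' → Dv ℕ true [F] (sub (back L) F')) ∧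
    (∀ F', Var L true F F' → Dv ℕ true [sub (back L) F'] F) := by
  intro F
  induction F with
  | prim n =>
    intro _
    constructor <;> rintro _ rfl <;> simp [sub, back] <;> exact Dv.ax _ _
  | ldiv A B iA iB =>
    intro h
    simp only [csub, List.append_subset] at h
    obtain ⟨a1, a2⟩ := iA h.1
    obtain ⟨b1, b2⟩ := iB h.2
    constructor
    · rintro _ ⟨A', B', h1, h2, rfl⟩
      exact mono_ldiv (a2 _ h1) (b1 _ h2)
    · rintro _ ⟨A', B', h1, h2, rfl⟩
      exact mono_ldiv (a1 _ h1) (b2 _ h2)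
  | rdiv B A iB iA =>
    intro h
    simp only [csub, List.append_subset] at h
    obtain ⟨a1, a2⟩ := iA h.2
    obtain ⟨b1, b2⟩ := iB h.1
    constructor
    · rintro _ ⟨A', B', h1, h2, rfl⟩
      exact mono_rdiv (a2 _ h1) (b1 _ h2)
    · rintro _ ⟨A', B', h1, h2, rfl⟩
      exact mono_rdiv (a1 _ h1) (b2 _ h2)
  | mul A B iA iB =>
    intro h
    simp only [csub, List.append_subset] at h
    obtain ⟨a1, a2⟩ := iA h.1
    obtain ⟨b1, b2⟩ := iB h.2
    constructor
    · rintro _ ⟨A', B', h1, h2, rfl⟩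
      exact mono_mul (a1 _ h1) (b1 _ h2)
    · rintro _ ⟨A', B', h1, h2, rfl⟩
      exact mono_mul (a2 _ h1) (b2 _ h2)
  | circ A iA =>
    intro h
    simp only [csub, List.cons_subset] at h
    obtain ⟨a1, a2⟩ := iA h.2
    constructor
    · rintro _ rfl
      rw [back_q L A h.1]
      exact Dv.ax _ _
    · rintro _ (⟨A', h1, rfl⟩ | ⟨B, hB, hD, rfl⟩)
      · exact Dv.circL _ _ _ (Dv.circR _ _ _ (a2 _ h1))
      · simp only [sub]
        rw [back_q L B hB]
        exact Dv.circL _ _ _ (Dv.circL _ _ _ hD)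

theorem cut_many {Ts Us : List (Fm ℕ)} (h : List.Forall₂ (fun T U => Dv ℕ true [T] U) Ts Us) :
    ∀ (Γ : List (Fm ℕ)) (C : Fm ℕ), Dv ℕ true (Γ ++ Us) C → Dv ℕ true (Γ ++ Ts) C := by
  induction h with
  | nil => intro Γ C h; exact h
  | @cons T U Ts Us h1 h2 ih =>
    intro Γ C h
    have h3 := Dv.cut Γ Us [T] U C h1 h (by simp)
    have := ih (Γ ++ [T]) C h3
    simpa using this

theorem f2_split {α β : Type} {R : α → β → Prop} {Γ Δ : List α} {X : List β}
    (h : List.Forall₂ R (Γ ++ Δ) X) :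
    ∃ Y Z, List.Forall₂ R Γ Y ∧ List.Forall₂ R Δ Z ∧ X = Y ++ Z := by
  induction Γ generalizing X with
  | nil => exact ⟨[], X, List.Forall₂.nil, h, rfl⟩
  | cons a Γ ih =>
    cases h with
    | cons h1 h2 =>
      obtain ⟨Y, Z, hY, hZ, rfl⟩ := ih h2
      exact ⟨_ :: Y, Z, List.Forall₂.cons h1 hY, hZ, rfl⟩

theorem f2_cons {α β : Type} {R : α → β → Prop} {a : α} {Δ : List α} {X : List β}
    (h : List.Forall₂ R (a :: Δ) X) :
    ∃ y Z, R a y ∧ List.Forall₂ R Δ Z ∧ X = y :: Z := by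
  cases h with
  | cons h1 h2 => exact ⟨_, _, h1, h2, rfl⟩

theorem f2_app {α β : Type} {R : α → β → Prop} {Γ Δ : List α} {X Y : List β}
    (h : List.Forall₂ R Γ X) (h' : List.Forall₂ R Δ Y) : List.Forall₂ R (Γ ++ Δ) (X ++ Y) := by
  induction h with
  | nil => exact h'
  | cons h1 _ ih => exact List.Forall₂.cons h1 ih

theorem f2_ne {α β : Type} {R : α → β → Prop} {Γ : List α} {X : List β}
    (h : List.Forall₂ R Γ X) (hΓ : Γ ≠ []) : X ≠ [] := by
  cases h <;> simp_all

theorem f2_trans {α β γ : Type} {R : α → β → Prop} {S : β → γ → Prop} {T : α → γ → Prop}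
    (hT : ∀ a b c, R a b → S b c → T a c) {X : List α} {Y : List β} {Z : List γ}
    (h : List.Forall₂ R X Y) (h' : List.Forall₂ S Y Z) : List.Forall₂ T X Z := by
  induction h generalizing Z with
  | nil => cases h'; exact List.Forall₂.nil
  | cons h1 _ ih =>
    cases h' with
    | cons h3 h4 => exact List.Forall₂.cons (hT _ _ _ h1 h3) (ih h4)

theorem Var_ax (L : List (Fm ℕ)) : ∀ F : Fm ℕ, csub F ⊆ L →
    ∃ N M, Var L false F N ∧ Var L true F M ∧ Dv ℕ true [N] M := by
  intro F
  induction F with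
  | prim n => exact fun _ => ⟨_, _, rfl, rfl, Dv.ax _ _⟩
  | ldiv A B iA iB =>
    intro h
    simp only [csub, List.append_subset] at h
    obtain ⟨N, M, h1, h2, h3⟩ := iA h.1
    obtain ⟨N', M', h1', h2', h3'⟩ := iB h.2
    exact ⟨_, _, ⟨_, _, h2, h1', rfl⟩, ⟨_, _, h1, h2', rfl⟩, mono_ldiv h3 h3'⟩
  | rdiv B A iB iA =>
    intro h
    simp only [csub, List.append_subset] at h
    obtain ⟨N, M, h1, h2, h3⟩ := iA h.2
    obtain ⟨N', M', h1', h2', h3'⟩ := iB h.1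
    exact ⟨_, _, ⟨_, _, h2, h1', rfl⟩, ⟨_, _, h1, h2', rfl⟩, mono_rdiv h3 h3'⟩
  | mul A B iA iB =>
    intro h
    simp only [csub, List.append_subset] at h
    obtain ⟨N, M, h1, h2, h3⟩ := iA h.1
    obtain ⟨N', M', h1', h2', h3'⟩ := iB h.2
    exact ⟨_, _, ⟨_, _, h1, h1', rfl⟩, ⟨_, _, h2, h2', rfl⟩, mono_mul h3 h3'⟩
  | circ A iA =>
    intro h
    simp only [csub, List.cons_subset] at h
    exact ⟨_, _, rfl, Or.inr ⟨A, h.1, Dv.circR _ _ _ (Dv.ax _ _), rfl⟩,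
      Dv.circR _ _ _ (Dv.ax _ _)⟩

theorem Var_complete (L : List (Fm ℕ)) {c : Bool} {Γ : List (Fm ℕ)} {C : Fm ℕ}
    (h : Dv ℕ c Γ C) (hc : c = false) (hΓ : ∀ F ∈ Γ, csub F ⊆ L) (hC : csub C ⊆ L) :
    ∃ Γ' C', List.Forall₂ (Var L false) Γ Γ' ∧ Var L true C C' ∧ Dv ℕ true Γ' C' := by
  induction h with
  | ax c A =>
    obtain ⟨N, M, h1, h2, h3⟩ := Var_ax L A hC
    exact ⟨[N], M, List.Forall₂.cons h1 List.Forall₂.nil, h2, h3⟩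
  | ldivL c Γ Δ Pi A B C h1 h2 hPi i1 i2 =>
    have hAB := hΓ (ldiv A B) (by simp)
    simp only [csub, List.append_subset] at hAB
    obtain ⟨X, C', hX, hC', hD⟩ := i1 hc (by
      intro F hF
      simp at hF
      rcases hF with hF | rfl | hF
      · exact hΓ F (by simp [hF])
      · exact hAB.2
      · exact hΓ F (by simp [hF])) hC
    obtain ⟨Pi', A', hP, hA', hD'⟩ := i2 hc (fun F hF => hΓ F (by simp [hF])) hAB.1
    obtain ⟨Γ', Z, hG, hZ, rfl⟩ := f2_split hX
    obtain ⟨B', Δ', hB, hΔ, rfl⟩ := f2_cons hZ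
    exact ⟨Γ' ++ Pi' ++ ldiv A' B' :: Δ', C',
      f2_app (f2_app hG hP) (List.Forall₂.cons ⟨_, _, hA', hB, rfl⟩ hΔ), hC',
      Dv.ldivL _ _ _ _ _ _ _ hD hD' (f2_ne hP hPi)⟩
  | ldivR c Pi A B _ h i =>
    simp only [csub, List.append_subset] at hC
    obtain ⟨X, C', hX, hC', hD⟩ := i hc (by simpa using ⟨hC.1, hΓ⟩) hC.2
    obtain ⟨A', Pi', hA, hP, rfl⟩ := f2_cons hX
    exact ⟨Pi', _, hP, ⟨_, _, hA, hC', rfl⟩, Dv.ldivR _ _ _ _ hD (f2_ne hP h)⟩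
  | rdivL c Γ Δ Pi A B C h1 h2 hPi i1 i2 =>
    have hAB := hΓ (rdiv B A) (by simp)
    simp only [csub, List.append_subset] at hAB
    obtain ⟨X, C', hX, hC', hD⟩ := i1 hc (by
      intro F hF
      simp at hF
      rcases hF with hF | rfl | hF
      · exact hΓ F (by simp [hF])
      · exact hAB.1
      · exact hΓ F (by simp [hF])) hC
    obtain ⟨Pi', A', hP, hA', hD'⟩ := i2 hc (fun F hF => hΓ F (by simp [hF])) hAB.2
    obtain ⟨Γ', Z, hG, hZ, rfl⟩ := f2_split hX
    obtain ⟨B', Δ', hB, hΔ, rfl⟩ := f2_cons hZ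
    exact ⟨Γ' ++ rdiv B' A' :: (Pi' ++ Δ'), C',
      f2_app hG (List.Forall₂.cons ⟨_, _, hA', hB, rfl⟩ (f2_app hP hΔ)), hC',
      Dv.rdivL _ _ _ _ _ _ _ hD hD' (f2_ne hP hPi)⟩
  | rdivR c Pi A B _ h i =>
    simp only [csub, List.append_subset] at hC
    obtain ⟨X, C', hX, hC', hD⟩ := i hc (by
      intro F hF
      simp at hF
      rcases hF with hF | rfl
      · exact hΓ F hF
      · exact hC.2) hC.1
    obtain ⟨Pi', Z, hP, hZ, rfl⟩ := f2_split hX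
    obtain ⟨A', Δ', hA, hΔ, rfl⟩ := f2_cons hZ
    cases hΔ
    exact ⟨Pi', _, hP, ⟨_, _, hA, hC', rfl⟩, Dv.rdivR _ _ _ _ hD (f2_ne hP h)⟩
  | mulL c Γ Δ A B C _ i =>
    have hAB := hΓ (mul A B) (by simp)
    simp only [csub, List.append_subset] at hAB
    obtain ⟨X, C', hX, hC', hD⟩ := i hc (by
      intro F hF
      simp at hF
      rcases hF with hF | rfl | rfl | hF
      · exact hΓ F (by simp [hF])
      · exact hAB.1
      · exact hAB.2
      · exact hΓ F (by simp [hF])) hC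
    obtain ⟨Γ', Z, hG, hZ, rfl⟩ := f2_split hX
    obtain ⟨A', Z', hA, hZ', rfl⟩ := f2_cons hZ
    obtain ⟨B', Δ', hB, hΔ, rfl⟩ := f2_cons hZ'
    exact ⟨Γ' ++ mul A' B' :: Δ', C', f2_app hG (List.Forall₂.cons ⟨_, _, hA, hB, rfl⟩ hΔ), hC',
      Dv.mulL _ _ _ _ _ _ hD⟩
  | mulR c Pi Psi A B _ _ h1 h2 i1 i2 =>
    simp only [csub, List.append_subset] at hC
    obtain ⟨X, A', hX, hA, hD⟩ := i1 hc (fun F hF => hΓ F (by simp [hF])) hC.1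
    obtain ⟨Y, B', hY, hB, hD'⟩ := i2 hc (fun F hF => hΓ F (by simp [hF])) hC.2
    exact ⟨X ++ Y, _, f2_app hX hY, ⟨_, _, hA, hB, rfl⟩,
      Dv.mulR _ _ _ _ _ hD hD' (f2_ne hX h1) (f2_ne hY h2)⟩
  | circR c Pi A _ i =>
    simp only [csub, List.cons_subset] at hC
    obtain ⟨X, A', hX, hA, hD⟩ := i hc hΓ hC.2
    exact ⟨X, _, hX, Or.inl ⟨_, hA, rfl⟩, Dv.circR _ _ _ hD⟩
  | circL c A B h i =>
    have hB := hΓ (circ B) (by simp)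
    simp only [csub, List.cons_subset] at hB
    exact ⟨[q L B], _, List.Forall₂.cons rfl List.Forall₂.nil,
      Or.inr ⟨B, hB.1, addcut h, rfl⟩, Dv.circR _ _ _ (Dv.ax _ _)⟩
  | circC c Pi Psi A _ h1 h2 i =>
    obtain ⟨X, A', hX, hA, hD⟩ := i hc (by
      intro F hF
      simp at hF
      rcases hF with hF | hF
      · exact hΓ F (by simp [hF])
      · exact hΓ F (by simp [hF])) hC
    obtain ⟨Y, Z, hY, hZ, rfl⟩ := f2_split hX
    refine ⟨Z ++ Y, A', f2_app hZ hY, hA, ?_⟩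
    rcases hA with ⟨_, _, rfl⟩ | ⟨_, _, _, rfl⟩
    · exact Dv.circC _ _ _ _ hD (f2_ne hY h1) (f2_ne hZ h2)
    · exact Dv.circC _ _ _ _ hD (f2_ne hY h1) (f2_ne hZ h2)
  | cut Γ Δ Pi A B _ _ h i1 i2 => cases hc

noncomputable def relV {α : Type} (L : List (Fm ℕ)) (rel : List (α × Fm ℕ)) : List (α × Fm ℕ) :=
  rel.flatMap (fun p => (Var_finite L p.2 false).toFinset.toList.map (fun F => (p.1, F)))

theorem mem_relV {α : Type} (L : List (Fm ℕ)) (rel : List (α × Fm ℕ)) (a : α) (F : Fm ℕ) :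
    (a, F) ∈ relV L rel ↔ ∃ T, (a, T) ∈ rel ∧ Var L false T F := by
  simp only [relV, List.mem_flatMap, List.mem_map, Finset.mem_toList, Set.Finite.mem_toFinset,
    Set.mem_ofPred_eq, Prod.mk.injEq]
  constructor
  · rintro ⟨p, hp, F, hF, rfl, rfl⟩
    exact ⟨p.2, hp, hF⟩
  · rintro ⟨T, hT, hF⟩
    exact ⟨(a, T), hT, F, hF, rfl, rfl⟩

theorem step2 (α : Type) (n : ℕ) (rel : List (α × Fm ℕ)) :
    ∃ (S' : Fm ℕ) (rel' : List (α × Fm ℕ)),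
      cyclicOK true S' ∧ (∀ p ∈ rel', cyclicOK false p.2) ∧
      GLang (Dv ℕ true) (prim n) rel = GLang (Dv ℕ true) S' rel' := by
  let L := rel.flatMap (fun p => csub p.2)
  have hL : ∀ a T, (a, T) ∈ rel → csub T ⊆ L := by
    intro a T h F hF
    exact List.mem_flatMap.2 ⟨(a, T), h, hF⟩
  refine ⟨prim (2 * n), relV L rel, by simp [cyclicOK], ?_, ?_⟩
  · rintro ⟨a, F⟩ h
    obtain ⟨T, _, hT⟩ := (mem_relV _ _ _ _).1 h
    exact Var_cyclic L _ _ _ hT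
  ext w
  constructor
  · rintro ⟨hw, Ts, hTs, hD⟩
    refine ⟨hw, ?_⟩
    have hsub : ∀ F ∈ Ts, csub F ⊆ L := by
      clear hD hw
      induction hTs with
      | nil => simp
      | cons h _ ih =>
        intro F hF
        simp at hF
        rcases hF with rfl | hF
        · exact hL _ _ h
        · exact ih F hF
    obtain ⟨Γ', C', h1, h2, h3⟩ := Var_complete L (cut_elim hD) rfl hsub (by simp [csub])
    cases h2
    exact ⟨Γ', f2_trans (fun a T F h h' => (mem_relV L rel a F).2 ⟨T, h, h'⟩) hTs h1, h3⟩
  · rintro ⟨hw, Us, hUs, hD⟩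
    refine ⟨hw, ?_⟩
    have : ∃ Ts, List.Forall₂ (fun a T => (a, T) ∈ rel) w Ts ∧
        List.Forall₂ (fun T U => Dv ℕ true [T] U) Ts (Us.map (sub (back L))) := by
      clear hD hw
      induction hUs with
      | nil => exact ⟨[], List.Forall₂.nil, List.Forall₂.nil⟩
      | cons h _ ih =>
        obtain ⟨Ts, h1, h2⟩ := ih
        obtain ⟨T, hT, hV⟩ := (mem_relV _ _ _ _).1 h
        exact ⟨T :: Ts, List.Forall₂.cons hT h1,
          List.Forall₂.cons ((Var_back L T (hL _ _ hT)).1 _ hV) h2⟩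
    obtain ⟨Ts, h1, h2⟩ := this
    have h3 := Dv.sub (back L) hD
    have h4 : sub (back L) (prim (2 * n)) = prim n := by simp [sub, back]
    rw [h4] at h3
    exact ⟨Ts, h1, cut_many h2 [] _ h3⟩

end LC

/-- Every `L^∘`-grammar can be converted into an equivalent even-cyclic
grammar: one whose distinguished type is even-cyclic and all of whose
dictionary types are odd-cyclic, recognizing the same language. -/
theorem Lcirc_grammar_even_cyclic (α : Type) (S : Fm ℕ) (rel : List (α × Fm ℕ)) :
    ∃ (S' : Fm ℕ) (rel' : List (α × Fm ℕ)),
      cyclicOK true S' ∧ (∀ p ∈ rel', cyclicOK false p.2) ∧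
      GLang (Dv ℕ true) S rel = GLang (Dv ℕ true) S' rel' := by
  obtain ⟨n, rel1, h1⟩ := LC.step1 α S rel
  obtain ⟨S2, rel2, h2, h3, h4⟩ := LC.step2 α n rel1
  exact ⟨S2, rel2, h2, h3, h1.trans h4⟩
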